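/- arXiv:1605.05443 — 2 statements merged into one kernel-verified Lean document; each statement's English description precedes it below -/
import Mathlib

section
/- Let φ be a monomorphism from H minus two edges e, f into H. Then φ(z) = z. -/
open Finset

/-- Edge r = {z, v1, v3, v5, v8} (z is vertex 0, vᵢ is vertex i). -/
def er : Finset (Fin 10) := {0, 1, 3, 5, 8}
/-- Edge g = {z, v2, v4, v7, v9}. -/
def eg : Finset (Fin 10) := {0, 2, 4, 7, 9}
/-- Edge a = {v1, v4, v6, v8, v9}. -/
def ea : Finset (Fin 10) := {1, 4, 6, 8, 9}
/-- Edge b = {v9, v1, v2, v3, v4}. -/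
def eb : Finset (Fin 10) := {9, 1, 2, 3, 4}
def ee1 : Finset (Fin 10) := {1, 2, 3, 4, 5}
def ee2 : Finset (Fin 10) := {2, 3, 4, 5, 6}
def ee3 : Finset (Fin 10) := {3, 4, 5, 6, 7}
def ee4 : Finset (Fin 10) := {4, 5, 6, 7, 8}
def ee5 : Finset (Fin 10) := {5, 6, 7, 8, 9}

/-- The edge set of the 5-uniform hypergraph H. -/
def Hedges : Finset (Finset (Fin 10)) := {er, eg, ea, eb, ee1, ee2, ee3, ee4, ee5}

/-- Degree of a vertex with respect to an edge set. -/
def deg (E : Finset (Finset (Fin 10))) (x : Fin 10) : ℕ :=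
  (E.filter (fun s => x ∈ s)).card

/-- The vertex set coded by a bit mask. -/
def ofMask (m : ℕ) : Finset (Fin 10) := univ.filter (fun x => m.testBit x.val = true)

/-- Bit masks of the edges e3, e4, e2, b, e1, e5, a, r, g. -/
def masks : List ℕ := [248, 496, 124, 542, 62, 992, 850, 299, 661]

/-- Number of vertices in the set coded by a mask. -/
def pcount (m : ℕ) : ℕ := ∑ x : Fin 10, (m.testBit x.val).toNat

/-- A computationally convenient form of `pcount`. -/
def pc (m : ℕ) : ℕ :=
  m % 2 + m / 2 % 2 + m / 4 % 2 + m / 8 % 2 + m / 16 % 2 + m / 32 % 2 + m / 64 % 2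
    + m / 128 % 2 + m / 256 % 2 + m / 512 % 2

theorem pc_eq (m : ℕ) : pc m = pcount m := by
  have h : ∀ i : ℕ, (m.testBit i).toNat = m / 2 ^ i % 2 := fun i => Nat.toNat_testBit m i
  simp [pc, pcount, Fin.sum_univ_succ, h]
  ring

/-- Refine a list of (source cell, target cell) pairs by a pair (edge, image edge). -/
def refineCells (s t : ℕ) : List (ℕ × ℕ) → List (ℕ × ℕ)
  | [] => []
  | c :: cs => (c.1 &&& s, c.2 &&& t) :: (c.1 ^^^ (c.1 &&& s), c.2 ^^^ (c.2 &&& t)) ::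
      refineCells s t cs

/-- Cells have matching sizes. -/
def okCells (cs : List (ℕ × ℕ)) : Bool := cs.all (fun c => (pc c.1).beq (pc c.2))

/-- The cells force vertex 0 to go to vertex 0. -/
def done (cs : List (ℕ × ℕ)) : Bool := cs.any (fun c => (c.1 % 2).beq 1 && c.2.beq 1)

/-- Backtracking search over images of edges; at most `k` edges may be skipped. -/
def search : List ℕ → ℕ → List (ℕ × ℕ) → Bool
  | [], _, cs => done cs
  | s :: es, k, cs => done cs ||
      ((match k with
        | 0 => true
        | k' + 1 => search es k' cs) &&
       masks.all (fun t =>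
        let n := (refineCells s t cs).filter (fun c => !(c.1.beq 0 && c.2.beq 0))
        !(okCells n) || search es k n))

theorem search_true : search masks 2 [(1023, 1023)] = true := by decide +kernel

/-- `φ` maps the set coded by `c.1` onto the one coded by `c.2`. -/
def CellInv (φ : Fin 10 → Fin 10) (c : ℕ × ℕ) : Prop :=
  ∀ x : Fin 10, c.1.testBit x.val = c.2.testBit (φ x).val

/-- The edge `s` is sent to an edge. -/
def Good (φ : Fin 10 → Fin 10) (s : ℕ) : Prop := ∃ t ∈ masks, CellInv φ (s, t)

theorem done_sound {φ : Fin 10 → Fin 10} {cs : List (ℕ × ℕ)} (h : done cs = true)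
    (hc : ∀ c ∈ cs, CellInv φ c) : φ 0 = 0 := by
  simp only [done, List.any_eq_true, Bool.and_eq_true, Nat.beq_eq] at h
  obtain ⟨c, hm, h1, h2⟩ := h
  have := hc c hm 0
  rw [h2] at this
  simp [h1] at this
  have key : ∀ y : Fin 10, Nat.testBit 1 y.val = true → y = 0 := by decide
  exact key _ this

theorem refine_inv {φ : Fin 10 → Fin 10} {s t : ℕ} (hst : CellInv φ (s, t)) (cs : List (ℕ × ℕ))
    (hc : ∀ c ∈ cs, CellInv φ c) : ∀ c ∈ refineCells s t cs, CellInv φ c := by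
  induction cs with
  | nil => simp [refineCells]
  | cons d ds ih =>
    have hd := hc d (by simp)
    intro c hcm
    simp only [refineCells, List.mem_cons] at hcm
    rcases hcm with rfl | rfl | h
    · intro x
      have h1 := hd x
      have h2 := hst x
      simp only at h2
      simp [h1, h2]
    · intro x
      have h1 := hd x
      have h2 := hst x
      simp only at h2
      simp [h1, h2]
    · exact ih (fun c hc' => hc c (by simp [hc'])) c h

theorem okCells_of_inv {φ : Fin 10 → Fin 10} (hφ : Function.Injective φ) (cs : List (ℕ × ℕ))
    (hc : ∀ c ∈ cs, CellInv φ c) : okCells cs = true := by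
  simp only [okCells, List.all_eq_true, Nat.beq_eq]
  intro c hm
  rw [pc_eq, pc_eq]
  have hb : Function.Bijective φ := Finite.injective_iff_bijective.mp hφ
  unfold pcount
  exact Function.Bijective.sum_comp hb (fun y : Fin 10 => (c.2.testBit y.val).toNat) ▸
    Finset.sum_congr rfl (fun x _ => by rw [hc c hm x])

open Classical in
theorem search_sound {φ : Fin 10 → Fin 10} (hφ : Function.Injective φ) (es : List ℕ) :
    ∀ (k : ℕ) (cs : List (ℕ × ℕ)), search es k cs = true →
      (es.filter (fun s => ¬ Good φ s)).length ≤ k → (∀ c ∈ cs, CellInv φ c) → φ 0 = 0 := by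
  induction es with
  | nil =>
    intro k cs h _ hc
    exact done_sound (by simpa [search] using h) hc
  | cons s es ih =>
    intro k cs h hk hc
    unfold search at h
    rw [Bool.or_eq_true, Bool.and_eq_true] at h
    rcases h with h | ⟨h1, h2⟩
    · exact done_sound h hc
    by_cases hs : Good φ s
    · obtain ⟨t, ht, hst⟩ := hs
      have h3 := List.all_eq_true.mp h2 t ht
      have hn : ∀ c ∈ (refineCells s t cs).filter (fun c => !(c.1.beq 0 && c.2.beq 0)), CellInv φ c :=
        fun c hcm => refine_inv hst cs hc c (List.mem_of_mem_filter hcm)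
      have hok := okCells_of_inv hφ _ hn
      simp only [hok, Bool.not_true, Bool.false_or] at h3
      refine ih k _ h3 ?_ hn
      have hg : Good φ s := ⟨t, ht, hst⟩
      simpa [hg] using hk
    · cases k with
      | zero => simp [hs] at hk
      | succ k' =>
        refine ih k' cs h1 ?_ hc
        simpa [hs] using hk

theorem masks_image : (masks.map ofMask).toFinset = Hedges := by decide +kernel

theorem masks_nodup : (masks.map ofMask).Nodup := by decide +kernel

theorem inv_of_image {φ : Fin 10 → Fin 10} (hφ : Function.Injective φ) {s t : ℕ}
    (h : (ofMask s).image φ = ofMask t) : CellInv φ (s, t) := by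
  intro x
  have h1 : φ x ∈ (ofMask s).image φ ↔ x ∈ ofMask s := by
    simp [hφ.eq_iff]
  rw [h] at h1
  simp only [ofMask, mem_filter, mem_univ, true_and] at h1
  exact (Bool.eq_iff_iff.mpr h1).symm

theorem stmt12 (e f : Finset (Fin 10)) (he : e ∈ Hedges) (hf : f ∈ Hedges)
    (φ : Fin 10 → Fin 10) (hφ : Function.Injective φ)
    (hmono : ∀ s ∈ Hedges \ {e, f}, s.image φ ∈ Hedges) :
    φ 0 = 0 := by
  classical
  refine search_sound hφ masks 2 [(1023, 1023)] search_true ?_ ?_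
  · have hnd : ((masks.filter (fun s => ¬ Good φ s)).map ofMask).Nodup :=
      masks_nodup.sublist (List.filter_sublist.map _)
    have hsub : ((masks.filter (fun s => ¬ Good φ s)).map ofMask).toFinset ⊆ {e, f} := by
      intro u hu
      simp only [List.mem_toFinset, List.mem_map, List.mem_filter, decide_eq_true_eq] at hu
      obtain ⟨s, ⟨hs, hng⟩, rfl⟩ := hu
      by_contra hne
      have hmem : ofMask s ∈ Hedges := by
        rw [← masks_image, List.mem_toFinset]
        exact List.mem_map_of_mem hs
      have h := hmono _ (mem_sdiff.mpr ⟨hmem, hne⟩)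
      rw [← masks_image, List.mem_toFinset, List.mem_map] at h
      obtain ⟨t, ht, hte⟩ := h
      exact hng ⟨t, ht, inv_of_image hφ hte.symm⟩
    have h1 := Finset.card_le_card hsub
    rw [List.toFinset_card_of_nodup hnd, List.length_map] at h1
    exact h1.trans Finset.card_le_two
  · intro c hc
    rw [List.mem_singleton] at hc
    subst hc
    have hall : ∀ y : Fin 10, Nat.testBit 1023 y.val = true := by decide
    intro x
    rw [hall x, hall (φ x)]
end

section
/- Let e, f be two edges of H with r, g ∈ H_{ef}, and let φ be a monomorphism from H_{ef} into H satisfying φ(r) = r and φ(g) = g. Then φ is the identity. -/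
open Finset

/-- The seven edges of H other than r and g. -/
def otherEdge : Fin 7 → Finset (Fin 10) := ![ea, eb, ee1, ee2, ee3, ee4, ee5]

/-- Bitmasks of the nine edges. -/
def good (m : ℕ) : Bool :=
  m == 299 || m == 661 || m == 850 || m == 542 || m == 62 || m == 124 || m == 248 ||
    m == 496 || m == 992

/-- Indicator of a mask that is not the mask of an edge. -/
def bad (m : ℕ) : ℕ := bif good m then 0 else 1

/-- Bitmask of a vertex set. -/
def mask (s : Finset (Fin 10)) : ℕ := ∑ x ∈ s, 2 ^ x.val

theorem good_of_mem (s : Finset (Fin 10)) (h : s ∈ Hedges) : good (mask s) = true := by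
  revert s
  decide +kernel

/-- Total number of bad images, for images of v1,v3,v5,v8 and v2,v4,v7,v9 given by weights. -/
def badCount (a b c d p q r s : ℕ) : ℕ :=
  bad (a + q + 64 + d + s) + bad (s + a + p + b + q) + bad (a + p + b + q + c) +
    bad (p + b + q + c + 64) + bad (b + q + c + 64 + r) + bad (q + c + 64 + r + d) +
    bad (c + 64 + r + d + s)

set_option synthInstance.maxHeartbeats 2000000 in
set_option synthInstance.maxSize 100000 in
set_option maxHeartbeats 4000000 in
/-- Exhaustive check over the 576 candidate maps. -/
theorem exhaust :
    ∀ a ∈ [1, 3, 5, 8], ∀ b ∈ [1, 3, 5, 8], a ≠ b → ∀ c ∈ [1, 3, 5, 8], a ≠ c → b ≠ c →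
    ∀ d ∈ [1, 3, 5, 8], a ≠ d → b ≠ d → c ≠ d →
    ∀ p ∈ [2, 4, 7, 9], ∀ q ∈ [2, 4, 7, 9], p ≠ q → ∀ r ∈ [2, 4, 7, 9], p ≠ r → q ≠ r →
    ∀ s ∈ [2, 4, 7, 9], p ≠ s → q ≠ s → r ≠ s →
    badCount (2 ^ a) (2 ^ b) (2 ^ c) (2 ^ d) (2 ^ p) (2 ^ q) (2 ^ r) (2 ^ s) ≤ 2 →
    (a = 1 ∧ b = 3 ∧ c = 5 ∧ d = 8 ∧ p = 2 ∧ q = 4 ∧ r = 7 ∧ s = 9) := by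
  decide +kernel

theorem stmt14 (e f : Finset (Fin 10)) (he : e ∈ Hedges) (hf : f ∈ Hedges)
    (φ : Fin 10 → Fin 10) (hφ : Function.Injective φ)
    (hmono : ∀ s ∈ Hedges \ {e, f}, s.image φ ∈ Hedges)
    (hr : er ∈ Hedges \ {e, f}) (hg : eg ∈ Hedges \ {e, f})
    (hφr : er.image φ = er) (hφg : eg.image φ = eg) :
    φ = id := by
  have hinj : Function.Injective otherEdge := by decide +kernel
  have hotherH : ∀ i, otherEdge i ∈ Hedges := by decide +kernel
  -- images of individual vertices
  have mr : ∀ x ∈ er, φ x ∈ er := fun x hx => hφr ▸ mem_image_of_mem φ hx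
  have mg : ∀ x ∈ eg, φ x ∈ eg := fun x hx => hφg ▸ mem_image_of_mem φ hx
  have h0 : φ 0 = 0 := by
    have h1 := mr 0 (by decide)
    have h2 := mg 0 (by decide)
    revert h1 h2
    generalize φ 0 = y
    revert y
    decide
  have ne0 : ∀ x, x ≠ 0 → φ x ≠ 0 := fun x hx h => hx (hφ (h.trans h0.symm))
  have lr : ∀ x ∈ er, x ≠ 0 → (φ x).val ∈ [1, 3, 5, 8] := by
    intro x hx hx0
    have h1 := mr x hx
    have h2 := ne0 x hx0
    revert h1 h2
    generalize φ x = y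
    revert y
    decide
  have lg : ∀ x ∈ eg, x ≠ 0 → (φ x).val ∈ [2, 4, 7, 9] := by
    intro x hx hx0
    have h1 := mg x hx
    have h2 := ne0 x hx0
    revert h1 h2
    generalize φ x = y
    revert y
    decide
  have h6 : φ 6 = 6 := by
    obtain ⟨x, hx⟩ := (Finite.surjective_of_injective hφ) 6
    have hxr : x ∉ er := fun h => absurd (hx ▸ mr x h) (by decide)
    have hxg : x ∉ eg := fun h => absurd (hx ▸ mg x h) (by decide)
    have : x = 6 := by
      clear hx
      revert x
      decide
    rw [← this, hx, this]
  have ne : ∀ x y, x ≠ y → (φ x).val ≠ (φ y).val :=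
    fun x y hxy h => hxy (hφ (Fin.ext h))
  -- at most two bad edges
  have hcard : ((univ : Finset (Fin 7)).filter
      (fun i => good (mask ((otherEdge i).image φ)) = false)).card ≤ 2 := by
    refine le_trans (card_le_card_of_injOn (t := {e, f}) otherEdge ?_ hinj.injOn) card_le_two
    intro i hi
    by_contra hn
    have h1 := good_of_mem _ (hmono (otherEdge i) (mem_sdiff.2 ⟨hotherH i, fun h => hn h⟩))
    have h2 := (mem_filter.1 hi).2
    rw [h1] at h2
    exact absurd h2 (by decide)
  have hm : ∀ s : Finset (Fin 10), mask (s.image φ) = ∑ x ∈ s, 2 ^ (φ x).val :=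
    fun s => sum_image (fun x _ y _ h => hφ h)
  have hbad : ∀ m, (if good m = false then 1 else 0) = bad m := by
    intro m
    unfold bad
    cases good m <;> rfl
  have hcount : badCount (2 ^ (φ 1).val) (2 ^ (φ 3).val) (2 ^ (φ 5).val) (2 ^ (φ 8).val)
      (2 ^ (φ 2).val) (2 ^ (φ 4).val) (2 ^ (φ 7).val) (2 ^ (φ 9).val) ≤ 2 := by
    rw [card_filter] at hcard
    simp only [hbad, Fin.sum_univ_seven, hm] at hcard
    have h64 : 2 ^ (φ 6).val = 64 := by rw [h6]; rfl
    simpa [otherEdge, ea, eb, ee1, ee2, ee3, ee4, ee5, badCount, h64, sum_insert,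
      add_assoc] using hcard
  obtain ⟨h1, h3, h5, h8, h2, h4, h7, h9⟩ := exhaust
    _ (lr 1 (by decide) (by decide)) _ (lr 3 (by decide) (by decide)) (ne _ _ (by decide))
    _ (lr 5 (by decide) (by decide)) (ne _ _ (by decide)) (ne _ _ (by decide))
    _ (lr 8 (by decide) (by decide)) (ne _ _ (by decide)) (ne _ _ (by decide))
    (ne _ _ (by decide))
    _ (lg 2 (by decide) (by decide)) _ (lg 4 (by decide) (by decide)) (ne _ _ (by decide))
    _ (lg 7 (by decide) (by decide)) (ne _ _ (by decide)) (ne _ _ (by decide))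
    _ (lg 9 (by decide) (by decide)) (ne _ _ (by decide)) (ne _ _ (by decide))
    (ne _ _ (by decide)) hcount
  funext x
  fin_cases x
  · exact h0
  · exact Fin.ext h1
  · exact Fin.ext h2
  · exact Fin.ext h3
  · exact Fin.ext h4
  · exact Fin.ext h5
  · exact h6
  · exact Fin.ext h7
  · exact Fin.ext h8
  · exact Fin.ext h9
end
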